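/- Let Ω ⊆ ℝⁿ be a bounded connected open set and λ > 0. If u is a stable solution of the Gelfand problem Δu + λe^u = 0 in Ω, u = 0 on ∂Ω, then for every solution w of the same problem one has ‖u‖_{L^∞(Ω)} ≤ ‖w‖_{L^∞(Ω)}; that is, the stable solution has the smallest L^∞ norm among all solutions. -/

import Mathlib

open Real MeasureTheory Metric Set Filter

noncomputable section

/-- The Euclidean Laplacian of `f : ℝⁿ → ℝ` at `x`. -/
def lap {n : ℕ} (f : EuclideanSpace ℝ (Fin n) → ℝ) (x : EuclideanSpace ℝ (Fin n)) : ℝ :=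
  ∑ i : Fin n, iteratedFDeriv ℝ 2 f x ![EuclideanSpace.single i 1, EuclideanSpace.single i 1]

open scoped Topology ContDiff Gradient

theorem IsLocalMin.deriv_deriv_nonneg {f : ℝ → ℝ} {x : ℝ} (h : IsLocalMin f x)
    (hc : ContinuousAt f x) : 0 ≤ deriv (deriv f) x := by
  by_contra! hneg
  have hmax := isLocalMax_of_deriv_deriv_neg hneg h.deriv_eq_zero hc
  have hconst : f =ᶠ[𝓝 x] fun _ => f x := by
    filter_upwards [h, hmax] with y h₁ h₂ using le_antisymm h₂ h₁
  have hzero := hconst.deriv.deriv_eq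
  simp at hzero
  exact hneg.ne hzero

section Laplacian

variable {n : ℕ}

local notation "𝔼" => EuclideanSpace ℝ (Fin n)

theorem lap_eq_sum_fderiv_fderiv (f : 𝔼 → ℝ) (x : 𝔼) :
    lap f x = ∑ i, fderiv ℝ (fderiv ℝ f) x (EuclideanSpace.single i 1)
      (EuclideanSpace.single i 1) := by
  simp [lap, iteratedFDeriv_two_apply]

theorem lap_sub {f g : 𝔼 → ℝ} {x : 𝔼} (hf : ContDiffAt ℝ 2 f x) (hg : ContDiffAt ℝ 2 g x) :
    lap (fun y => f y - g y) x = lap f x - lap g x := by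
  change lap (f - g) x = _
  simp [lap, iteratedFDeriv_sub_apply hf hg, Finset.sum_sub_distrib]

theorem IsLocalMin.lap_nonneg {f : 𝔼 → ℝ} {x : 𝔼} (h : IsLocalMin f x)
    (hf : ContDiffAt ℝ 2 f x) : 0 ≤ lap f x := by
  rw [lap_eq_sum_fderiv_fderiv]
  refine Finset.sum_nonneg fun i _ => ?_
  set e : 𝔼 := EuclideanSpace.single i 1
  have hline : ∀ t : ℝ, HasDerivAt (fun t : ℝ => x + t • e) e t := fun t => by
    simpa using ((hasDerivAt_id t).smul_const e).const_add x
  have hlim : Tendsto (fun t : ℝ => x + t • e) (𝓝 0) (𝓝 x) := by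
    simpa using (hline 0).continuousAt.tendsto
  have hmin : IsLocalMin (fun t : ℝ => f (x + t • e)) 0 := by
    filter_upwards [hlim.eventually h] with t ht
    simpa using ht
  have hdiff : ∀ᶠ y in 𝓝 x, DifferentiableAt ℝ f y := by
    filter_upwards [hf.eventually (by simp)] with y hy using hy.differentiableAt (by simp)
  have hderiv : deriv (fun t : ℝ => f (x + t • e)) =ᶠ[𝓝 0] fun t => fderiv ℝ f (x + t • e) e := by
    filter_upwards [hlim.eventually hdiff] with t ht
    exact (ht.hasFDerivAt.comp_hasDerivAt t (hline t)).deriv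
  have hsecond : DifferentiableAt ℝ (fderiv ℝ f) (x + (0 : ℝ) • e) := by
    simpa using (hf.fderiv_right (m := 1) (by norm_num)).differentiableAt (by simp)
  have hcomp : HasDerivAt (fun t : ℝ => fderiv ℝ f (x + t • e))
      (fderiv ℝ (fderiv ℝ f) (x + (0 : ℝ) • e) e) 0 :=
    hsecond.hasFDerivAt.comp_hasDerivAt (0 : ℝ) (hline 0)
  have hdd : HasDerivAt (fun t : ℝ => fderiv ℝ f (x + t • e) e)
      (fderiv ℝ (fderiv ℝ f) x e e) 0 := by
    simpa using hcomp.clm_apply (hasDerivAt_const (0 : ℝ) e)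
  rw [← hdd.deriv, ← hderiv.deriv_eq]
  exact hmin.deriv_deriv_nonneg
    (hf.continuousAt.comp_of_eq (hline 0).continuousAt (by simp))

/-- The minimum principle for strictly superharmonic functions. -/
theorem nonneg_of_lap_neg {Ω : Set 𝔼} (hΩ : IsOpen Ω) (hb : Bornology.IsBounded Ω) {u : 𝔼 → ℝ}
    (hu : ContDiffOn ℝ 2 u (closure Ω)) (hlap : ∀ x ∈ Ω, lap u x < 0)
    (h0 : ∀ x ∈ frontier Ω, u x = 0) : ∀ x ∈ Ω, 0 ≤ u x := by
  intro x hx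
  obtain ⟨y, hy, hmin⟩ := hb.isCompact_closure.exists_isMinOn ⟨x, subset_closure hx⟩
    hu.continuousOn
  by_cases hyΩ : y ∈ Ω
  · have hnhds : closure Ω ∈ 𝓝 y := mem_of_superset (hΩ.mem_nhds hyΩ) subset_closure
    exact absurd ((hmin.isLocalMin hnhds).lap_nonneg (hu.contDiffAt hnhds))
      (hlap y hyΩ).not_ge
  · rw [← h0 y (hΩ.frontier_eq ▸ ⟨hy, hyΩ⟩)]
    exact hmin (subset_closure hx)

end Laplacian

theorem ContDiffOn.contDiff_indicator {E F : Type*} [NormedAddCommGroup E] [NormedSpace ℝ E]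
    [NormedAddCommGroup F] [NormedSpace ℝ F] {Ω K : Set E} (hΩ : IsOpen Ω) (hK : IsClosed K)
    (hKΩ : K ⊆ Ω) {f : E → F} {k : ℕ∞ω} (hf : ContDiffOn ℝ k f Ω)
    (hzero : ∀ x ∈ Ω, x ∉ K → f x = 0) : ContDiff ℝ k (Ω.indicator f) := by
  rw [contDiff_iff_contDiffAt]
  intro x
  by_cases hx : x ∈ Ω
  · exact (hf.contDiffAt (hΩ.mem_nhds hx)).congr_of_eventuallyEq
      (eqOn_indicator.eventuallyEq_of_mem (hΩ.mem_nhds hx))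
  · have hloc : Ω.indicator f =ᶠ[𝓝 x] fun _ => 0 := by
      filter_upwards [hK.isOpen_compl.mem_nhds fun h => hx (hKΩ h)] with y hy
      exact indicator_apply_eq_zero.2 fun hyΩ => hzero y hyΩ hy
    exact contDiffAt_const.congr_of_eventuallyEq hloc

theorem tsupport_indicator_subset {E F : Type*} [TopologicalSpace E] [Zero F] {Ω K : Set E}
    (hK : IsClosed K) {f : E → F}
    (hzero : ∀ x ∈ Ω, x ∉ K → f x = 0) : tsupport (Ω.indicator f) ⊆ K := by
  refine closure_minimal (fun x hx => ?_) hK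
  by_contra hxK
  exact hx (indicator_apply_eq_zero.2 fun hxΩ => hzero x hxΩ hxK)

theorem integral_fderiv_apply_eq_zero {E : Type*} [NormedAddCommGroup E] [NormedSpace ℝ E]
    [FiniteDimensional ℝ E] [MeasurableSpace E] [BorelSpace E] (μ : Measure E)
    [μ.IsAddHaarMeasure] {F : E → ℝ} (hF : ContDiff ℝ 1 F) (hc : HasCompactSupport F) (e : E) :
    ∫ x, fderiv ℝ F x e ∂μ = 0 := by
  have hint : Integrable (fun x => fderiv ℝ F x e) μ :=
    ((hF.continuous_fderiv (by simp)).clm_apply continuous_const).integrable_of_hasCompactSupport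
      (hc.fderiv_apply ℝ e)
  have h := integral_mul_fderiv_eq_neg_fderiv_mul_of_integrable (μ := μ) (f := F) (v := e)
    (g := fun _ => (1 : ℝ)) (by simpa using hint) (by simp)
    (by simpa using hF.continuous.integrable_of_hasCompactSupport hc)
    (fun x _ => hF.differentiable (by simp) x) (fun x _ => differentiableAt_const _)
  simpa using h

section Truncation

theorem hasDerivAt_primitive {η : ℝ → ℝ} (hη : Continuous η) (t : ℝ) :
    HasDerivAt (fun t => ∫ s in (0 : ℝ)..t, η s) (η t) t :=
  intervalIntegral.integral_hasDerivAt_right (hη.intervalIntegrable _ _)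
    hη.stronglyMeasurable.stronglyMeasurableAtFilter hη.continuousAt

theorem contDiff_one_primitive {η : ℝ → ℝ} (hη : Continuous η) :
    ContDiff ℝ 1 fun t => ∫ s in (0 : ℝ)..t, η s := by
  rw [contDiff_one_iff_deriv]
  refine ⟨fun t => (hasDerivAt_primitive hη t).differentiableAt, ?_⟩
  rwa [funext fun t => (hasDerivAt_primitive hη t).deriv]

theorem primitive_eq_zero {η : ℝ → ℝ} {ε : ℝ} (hε : 0 < ε) (hη : ∀ s ≤ ε, η s = 0) {t : ℝ}
    (ht : t ≤ ε) : ∫ s in (0 : ℝ)..t, η s = 0 := by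
  rw [intervalIntegral.integral_congr (g := fun _ => (0 : ℝ))]
  · simp
  · intro s hs
    exact hη s (hs.2.trans (max_le hε.le ht))

theorem primitive_le_max {η : ℝ → ℝ} (hη : Continuous η) {ε : ℝ} (hε : 0 < ε)
    (hzero : ∀ s ≤ ε, η s = 0) (hle : ∀ s, η s ≤ 1) (t : ℝ) :
    ∫ s in (0 : ℝ)..t, η s ≤ max t 0 := by
  rcases le_total t ε with ht | ht
  · simp [primitive_eq_zero hε hzero ht]
  · have ht0 := hε.le.trans ht
    calc ∫ s in (0 : ℝ)..t, η s ≤ ∫ s in (0 : ℝ)..t, (1 : ℝ) :=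
          intervalIntegral.integral_mono_on ht0 (hη.intervalIntegrable _ _)
            (by simp) fun s _ => hle s
      _ ≤ max t 0 := by simp

/-- A `C¹` truncation `g` of the positive part, vanishing below `ε`, with
`h` the primitive of the squared derivative of `g`. -/
theorem exists_truncation {ε : ℝ} (hε : 0 < ε) :
    ∃ g h η : ℝ → ℝ, ContDiff ℝ 1 g ∧ ContDiff ℝ 1 h ∧
      (∀ t, HasDerivAt g (η t) t) ∧ (∀ t, HasDerivAt h (η t ^ 2) t) ∧
      (∀ t ≤ ε, g t = 0) ∧ (∀ t ≤ ε, h t = 0) ∧ (∀ t, h t ≤ max t 0) ∧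
      ∀ t, max t 0 ^ 2 - 4 * ε * max t 0 ≤ g t ^ 2 := by
  let η : ℝ → ℝ := fun s => max 0 (min 1 (s / ε - 1))
  have hη : Continuous η := by fun_prop
  have hη0 : ∀ s, 0 ≤ η s := fun s => le_max_left _ _
  have hη1 : ∀ s, η s ≤ 1 := fun s => max_le zero_le_one (min_le_left _ _)
  have hzero : ∀ s ≤ ε, η s = 0 := fun s hs => by
    have : s / ε - 1 ≤ 0 := by rw [sub_nonpos, div_le_one hε]; exact hs
    exact max_eq_left ((min_le_right _ _).trans this)
  have hone : ∀ s, 2 * ε ≤ s → η s = 1 := fun s hs => by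
    have : 1 ≤ s / ε - 1 := by
      rw [le_sub_iff_add_le, le_div_iff₀ hε]; linarith
    simp [η, min_eq_left this]
  have hsq0 : ∀ s ≤ ε, η s ^ 2 = 0 := fun s hs => by simp [hzero s hs]
  refine ⟨fun t => ∫ s in (0 : ℝ)..t, η s, fun t => ∫ s in (0 : ℝ)..t, η s ^ 2, η,
    contDiff_one_primitive hη, contDiff_one_primitive (hη.pow 2), hasDerivAt_primitive hη,
    hasDerivAt_primitive (hη.pow 2), fun t => primitive_eq_zero hε hzero,
    fun t => primitive_eq_zero hε hsq0,
    primitive_le_max (hη.pow 2) hε hsq0 fun s => pow_le_one₀ (hη0 s) (hη1 s), fun t => ?_⟩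
  rcases le_total t (2 * ε) with ht | ht
  · refine le_trans ?_ (sq_nonneg _)
    nlinarith [le_max_right t 0, max_le ht (by positivity : 0 ≤ 2 * ε)]
  · have hlow : t - 2 * ε ≤ ∫ s in (0 : ℝ)..t, η s := by
      rw [← intervalIntegral.integral_add_adjacent_intervals
        (hη.intervalIntegrable 0 (2 * ε)) (hη.intervalIntegrable (2 * ε) t)]
      have htail : ∫ s in (2 * ε)..t, η s = t - 2 * ε := by
        rw [intervalIntegral.integral_congr (g := fun _ => (1 : ℝ))]
        · simp
        · intro s hs
          rw [uIcc_of_le ht] at hs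
          exact hone s hs.1
      have hhead : 0 ≤ ∫ s in (0 : ℝ)..(2 * ε), η s :=
        intervalIntegral.integral_nonneg (by positivity) fun s _ => hη0 s
      linarith
    have ht0 : 0 ≤ t := by linarith
    simp only [max_eq_left ht0]
    nlinarith [pow_le_pow_left₀ (sub_nonneg.2 ht) hlow 2, sq_nonneg ε]

end Truncation

section Energy

variable {n : ℕ}

local notation "𝔼" => EuclideanSpace ℝ (Fin n)

theorem norm_gradient_sq (f : 𝔼 → ℝ) (x : 𝔼) :
    ‖∇ f x‖ ^ 2 = ∑ i, fderiv ℝ f x (EuclideanSpace.single i 1) ^ 2 := by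
  rw [← (EuclideanSpace.basisFun (Fin n) ℝ).sum_sq_inner_left]
  simp [gradient, InnerProductSpace.toDual_symm_apply]

theorem fderiv_indicator {Ω : Set 𝔼} (hΩ : IsOpen Ω) (f : 𝔼 → ℝ) {x : 𝔼} (hx : x ∈ Ω) :
    fderiv ℝ (Ω.indicator f) x = fderiv ℝ f x :=
  (eqOn_indicator.eventuallyEq_of_mem (hΩ.mem_nhds hx)).fderiv_eq

theorem isCompact_superlevel {Ω : Set 𝔼} (hb : Bornology.IsBounded Ω) {v : 𝔼 → ℝ}
    (hv : ContinuousOn v (closure Ω)) (ε : ℝ) : IsCompact (closure Ω ∩ v ⁻¹' Ici ε) :=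
  hb.isCompact_closure.of_isClosed_subset
    (hv.preimage_isClosed_of_isClosed isClosed_closure isClosed_Ici) inter_subset_left

theorem superlevel_subset {Ω : Set 𝔼} (hΩ : IsOpen Ω) {v : 𝔼 → ℝ}
    (h0 : ∀ x ∈ frontier Ω, v x = 0) {ε : ℝ} (hε : 0 < ε) : closure Ω ∩ v ⁻¹' Ici ε ⊆ Ω := by
  rintro x ⟨hx, hxε⟩
  by_contra hxΩ
  have hle : ε ≤ v x := hxε
  rw [h0 x (hΩ.frontier_eq ▸ ⟨hx, hxΩ⟩)] at hle
  exact hε.not_ge hle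

/-- Testing the negative Laplacian of `v` against `h ∘ v`, where the derivative of `h` is the square
of that of `g`, yields the Dirichlet energy of `g ∘ v`. -/
theorem integral_norm_gradient_sq_truncation {Ω : Set 𝔼} (hΩ : IsOpen Ω)
    (hb : Bornology.IsBounded Ω) {v : 𝔼 → ℝ} (hv : ContDiffOn ℝ 2 v (closure Ω))
    (h0 : ∀ x ∈ frontier Ω, v x = 0) {ε : ℝ} (hε : 0 < ε) {g h η : ℝ → ℝ}
    (hg : ContDiff ℝ 1 g) (hh : ContDiff ℝ 1 h) (hg' : ∀ t, HasDerivAt g (η t) t)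
    (hh' : ∀ t, HasDerivAt h (η t ^ 2) t) (hg0 : ∀ t ≤ ε, g t = 0) (hh0 : ∀ t ≤ ε, h t = 0) :
    ContDiff ℝ 1 (Ω.indicator (g ∘ v)) ∧ HasCompactSupport (Ω.indicator (g ∘ v)) ∧
      tsupport (Ω.indicator (g ∘ v)) ⊆ Ω ∧
      ∫ x in Ω, ‖∇ (Ω.indicator (g ∘ v)) x‖ ^ 2 = ∫ x in Ω, -lap v x * h (v x) := by
  set K := closure Ω ∩ v ⁻¹' Ici ε with hKdef
  have hK : IsCompact K := isCompact_superlevel hb hv.continuousOn ε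
  have hKΩ : K ⊆ Ω := superlevel_subset hΩ h0 hε
  have hsmall : ∀ x ∈ Ω, x ∉ K → v x ≤ ε := fun x hx hxK =>
    le_of_lt (not_le.1 fun hle => hxK ⟨subset_closure hx, hle⟩)
  have hvΩ : ContDiffOn ℝ 2 v Ω := hv.mono subset_closure
  have hvat : ∀ x ∈ Ω, ContDiffAt ℝ 2 v x := fun x hx => hvΩ.contDiffAt (hΩ.mem_nhds hx)
  have hvd : ∀ x ∈ Ω, HasFDerivAt v (fderiv ℝ v x) x := fun x hx =>
    ((hvat x hx).differentiableAt (by simp)).hasFDerivAt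
  have hv1 : ContDiffOn ℝ 1 (fderiv ℝ v) Ω := hvΩ.fderiv_of_isOpen hΩ (by norm_num)
  have hgz : ∀ x ∈ Ω, x ∉ K → (g ∘ v) x = 0 := fun x hx hxK => hg0 _ (hsmall x hx hxK)
  have hφ : ContDiff ℝ 1 (Ω.indicator (g ∘ v)) :=
    (hg.comp_contDiffOn (hvΩ.of_le (by norm_num))).contDiff_indicator hΩ hK.isClosed hKΩ hgz
  have hφs : tsupport (Ω.indicator (g ∘ v)) ⊆ K := tsupport_indicator_subset hK.isClosed hgz
  have hφc : HasCompactSupport (Ω.indicator (g ∘ v)) :=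
    hK.of_isClosed_subset (isClosed_tsupport _) hφs
  refine ⟨hφ, hφc, hφs.trans hKΩ, ?_⟩
  let e : Fin n → 𝔼 := fun i => EuclideanSpace.single i 1
  let F : Fin n → 𝔼 → ℝ := fun i => Ω.indicator fun x => h (v x) * fderiv ℝ v x (e i)
  have hFz : ∀ i, ∀ x ∈ Ω, x ∉ K → h (v x) * fderiv ℝ v x (e i) = 0 := fun i x hx hxK => by
    simp [hh0 _ (hsmall x hx hxK)]
  have hF : ∀ i, ContDiff ℝ 1 (F i) := fun i =>
    ((hh.comp_contDiffOn (hvΩ.of_le (by norm_num))).mul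
      (hv1.clm_apply contDiffOn_const)).contDiff_indicator hΩ hK.isClosed hKΩ (hFz i)
  have hFs : ∀ i, tsupport (F i) ⊆ K := fun i => tsupport_indicator_subset hK.isClosed (hFz i)
  have hFc : ∀ i, HasCompactSupport (F i) := fun i =>
    hK.of_isClosed_subset (isClosed_tsupport _) (hFs i)
  have hFint : ∀ i, Integrable (fun x => fderiv ℝ (F i) x (e i)) := fun i =>
    (((hF i).continuous_fderiv (by simp)).clm_apply
      continuous_const).integrable_of_hasCompactSupport ((hFc i).fderiv_apply ℝ (e i))
  have hdiv : ∫ x in Ω, ∑ i, fderiv ℝ (F i) x (e i) = 0 := by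
    rw [setIntegral_eq_integral_of_forall_compl_eq_zero, integral_finsetSum _ fun i _ => hFint i]
    · exact Finset.sum_eq_zero fun i _ => integral_fderiv_apply_eq_zero volume (hF i) (hFc i) (e i)
    · intro x hx
      refine Finset.sum_eq_zero fun i _ => ?_
      rw [fderiv_of_notMem_tsupport ℝ fun hxs => hx (hKΩ (hFs i hxs)), zero_apply]
  have hpoint : ∀ x ∈ Ω, ∑ i, fderiv ℝ (F i) x (e i) =
      ‖∇ (Ω.indicator (g ∘ v)) x‖ ^ 2 - -lap v x * h (v x) := by
    intro x hx
    rw [norm_gradient_sq, lap_eq_sum_fderiv_fderiv, fderiv_indicator hΩ _ hx,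
      ((hg' (v x)).comp_hasFDerivAt x (hvd x hx)).fderiv, neg_mul, sub_neg_eq_add,
      Finset.sum_mul, ← Finset.sum_add_distrib]
    refine Finset.sum_congr rfl fun i _ => ?_
    have hsecond := ((hv1.contDiffAt (hΩ.mem_nhds hx)).differentiableAt (by simp)).hasFDerivAt
    have hprod := ((hh' (v x)).comp_hasFDerivAt x (hvd x hx)).mul
      (hsecond.clm_apply (hasFDerivAt_const (e i) x))
    have hfd : fderiv ℝ (fun y => h (v y) * fderiv ℝ v y (e i)) x = _ := hprod.fderiv
    rw [fderiv_indicator hΩ _ hx, hfd]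
    simp [e]
    ring
  have hgradint : Integrable fun x => ‖∇ (Ω.indicator (g ∘ v)) x‖ ^ 2 := by
    simp_rw [norm_gradient_sq]
    refine integrable_finsetSum _ fun i _ => ?_
    have hs := hφc.fderiv_apply ℝ (EuclideanSpace.single i 1)
    refine Continuous.integrable_of_hasCompactSupport
      (((hφ.continuous_fderiv (by simp)).clm_apply continuous_const).pow 2) ?_
    exact hs.comp_left (g := fun t : ℝ => t ^ 2) (by simp)
  have hsumint : IntegrableOn (fun x => ∑ i, fderiv ℝ (F i) x (e i)) Ω :=
    (integrable_finsetSum _ fun i _ => hFint i).integrableOn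
  have hrhs : IntegrableOn (fun x => -lap v x * h (v x)) Ω :=
    (hgradint.integrableOn.sub hsumint).congr_fun
      (fun x hx => by simp [hpoint x hx]) hΩ.measurableSet
  rw [setIntegral_congr_fun hΩ.measurableSet hpoint, integral_sub hgradint.integrableOn hrhs,
    sub_eq_zero] at hdiv
  exact hdiv

end Energy

theorem exp_sub_exp_mul_le (a b : ℝ) :
    (exp a - exp b) * max (a - b) 0 ≤ exp a * max (a - b) 0 ^ 2 := by
  rcases le_total (a - b) 0 with h | h
  · simp [max_eq_right h]
  · have hb : exp b = exp a * exp (b - a) := by rw [← exp_add]; congr 1; ring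
    rw [max_eq_left h, hb]
    nlinarith [mul_nonneg (mul_nonneg (exp_pos a).le h)
      (sub_nonneg.2 (add_one_le_exp (b - a)))]

theorem exp_sub_exp_mul_lt {a b : ℝ} (hab : b < a) :
    (exp a - exp b) * max (a - b) 0 < exp a * max (a - b) 0 ^ 2 := by
  have h : 0 < a - b := sub_pos.2 hab
  have hb : exp b = exp a * exp (b - a) := by rw [← exp_add]; congr 1; ring
  rw [max_eq_left h.le, hb]
  nlinarith [mul_pos (mul_pos (exp_pos a) h)
    (sub_pos.2 (add_one_lt_exp (sub_neg.2 hab).ne))]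

theorem stable_le_of_solution {n : ℕ} {Ω : Set (EuclideanSpace ℝ (Fin n))}
    (hΩ : IsOpen Ω) (hb : Bornology.IsBounded Ω) {lam : ℝ} (hlam : 0 < lam)
    {u w : EuclideanSpace ℝ (Fin n) → ℝ}
    (hu : ContDiffOn ℝ 2 u (closure Ω)) (hw : ContDiffOn ℝ 2 w (closure Ω))
    (hequ : ∀ x ∈ Ω, lap u x + lam * exp (u x) = 0)
    (heqw : ∀ x ∈ Ω, lap w x + lam * exp (w x) = 0)
    (hbdry : ∀ x ∈ frontier Ω, u x = w x)
    (hstab : ∀ φ : EuclideanSpace ℝ (Fin n) → ℝ, ContDiff ℝ 1 φ → HasCompactSupport φ →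
      tsupport φ ⊆ Ω →
      lam * ∫ x in Ω, exp (u x) * φ x ^ 2 ≤ ∫ x in Ω, ‖gradient φ x‖ ^ 2) :
    ∀ x ∈ Ω, u x ≤ w x := by
  have hint : ∀ f : EuclideanSpace ℝ (Fin n) → ℝ, ContinuousOn f (closure Ω) →
      IntegrableOn f Ω := fun f hf =>
    (hf.integrableOn_compact hb.isCompact_closure).mono_set subset_closure
  have huc := hu.continuousOn
  have hwc := hw.continuousOn
  have hec : ContinuousOn (fun x => exp (u x)) (closure Ω) := huc.rexp
  have hdc : ContinuousOn (fun x => exp (u x) - exp (w x)) (closure Ω) := hec.sub hwc.rexp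
  have hpc : ContinuousOn (fun x => max (u x - w x) 0) (closure Ω) :=
    (huc.sub hwc).sup continuousOn_const
  let q : EuclideanSpace ℝ (Fin n) → ℝ := fun x =>
    exp (u x) * max (u x - w x) 0 ^ 2 - (exp (u x) - exp (w x)) * max (u x - w x) 0
  have hqc : ContinuousOn q (closure Ω) := (hec.mul (hpc.pow 2)).sub (hdc.mul hpc)
  have hbound : ∀ ε : ℝ, 0 < ε →
      ∫ x in Ω, q x ≤ ε * ∫ x in Ω, 4 * (exp (u x) * max (u x - w x) 0) := by
    intro ε hε
    obtain ⟨g, h, η, hg, hh, hg', hh', hg0, hh0, hhle, hgsq⟩ := exists_truncation hε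
    obtain ⟨hφ, hφc, hφs, henergy⟩ := integral_norm_gradient_sq_truncation hΩ hb (hu.sub hw)
      (fun x hx => sub_eq_zero.2 (hbdry x hx)) hε hg hh hg' hh' hg0 hh0
    have hst := hstab _ hφ hφc hφs
    have hgc : ContinuousOn (fun x => g (u x - w x)) (closure Ω) :=
      hg.continuous.comp_continuousOn (huc.sub hwc)
    have hhc : ContinuousOn (fun x => h (u x - w x)) (closure Ω) :=
      hh.continuous.comp_continuousOn (huc.sub hwc)
    have hI₁ : IntegrableOn (fun x => (exp (u x) - exp (w x)) * h (u x - w x)) Ω :=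
      hint _ (hdc.mul hhc)
    have hI₂ : IntegrableOn (fun x => exp (u x) * g (u x - w x) ^ 2) Ω :=
      hint _ (hec.mul (hgc.pow 2))
    have hI₃ : IntegrableOn (fun x => ε * (4 * (exp (u x) * max (u x - w x) 0))) Ω :=
      hint _ (continuousOn_const.mul (continuousOn_const.mul (hec.mul hpc)))
    have hlhs : ∫ x in Ω, exp (u x) * Ω.indicator (g ∘ (u - w)) x ^ 2 =
        ∫ x in Ω, exp (u x) * g (u x - w x) ^ 2 :=
      setIntegral_congr_fun hΩ.measurableSet fun x hx => by simp [indicator_of_mem hx]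
    have hrhs : ∫ x in Ω, -lap (u - w) x * h ((u - w) x) =
        lam * ∫ x in Ω, (exp (u x) - exp (w x)) * h (u x - w x) := by
      rw [← integral_const_mul]
      refine setIntegral_congr_fun hΩ.measurableSet fun x hx => ?_
      have hnhds : closure Ω ∈ nhds x := mem_of_superset (hΩ.mem_nhds hx) subset_closure
      have hlapsub : lap (u - w) x = lap u x - lap w x :=
        lap_sub (hu.contDiffAt hnhds) (hw.contDiffAt hnhds)
      simp only [hlapsub, eq_neg_of_add_eq_zero_left (hequ x hx),
        eq_neg_of_add_eq_zero_left (heqw x hx), Pi.sub_apply]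
      ring
    have hcore : ∫ x in Ω, exp (u x) * g (u x - w x) ^ 2 ≤
        ∫ x in Ω, (exp (u x) - exp (w x)) * h (u x - w x) := by
      refine le_of_mul_le_mul_left ?_ hlam
      rw [← hlhs, ← hrhs]
      exact hst.trans_eq henergy
    have hnonneg : 0 ≤ ∫ x in Ω, ((exp (u x) - exp (w x)) * h (u x - w x) -
        exp (u x) * g (u x - w x) ^ 2) := by
      rw [integral_sub hI₁ hI₂]
      exact sub_nonneg.2 hcore
    rw [← integral_const_mul, ← sub_nonneg,
      ← integral_sub hI₃ (hint _ hqc)]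
    refine hnonneg.trans (setIntegral_mono_on (hI₁.sub hI₂) (hI₃.sub (hint _ hqc))
      hΩ.measurableSet fun x _ => ?_)
    have h₁ : (exp (u x) - exp (w x)) * h (u x - w x) ≤
        (exp (u x) - exp (w x)) * max (u x - w x) 0 := by
      rcases le_total (u x - w x) 0 with hle | hle
      · rw [hh0 _ (hle.trans hε.le), max_eq_right hle]
      · exact mul_le_mul_of_nonneg_left (hhle _)
          (sub_nonneg.2 (exp_le_exp.2 (sub_nonneg.1 hle)))
    have h₂ := mul_le_mul_of_nonneg_left (hgsq (u x - w x)) (exp_pos (u x)).le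
    simp only [q]
    linarith
  have hq0 : ∀ x, 0 ≤ q x := fun x => sub_nonneg.2 (exp_sub_exp_mul_le _ _)
  have hqle : ∫ x in Ω, q x ≤ 0 := by
    refine ge_of_tendsto (f := fun ε : ℝ =>
      ε * ∫ x in Ω, 4 * (exp (u x) * max (u x - w x) 0)) (x := 𝓝[>] 0) ?_
      (by filter_upwards [self_mem_nhdsWithin] with ε hε using hbound ε hε)
    exact tendsto_nhdsWithin_of_tendsto_nhds
      (by simpa using (continuous_mul_const (∫ x in Ω, 4 * (exp (u x) *
        max (u x - w x) 0))).tendsto 0)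
  have hqint : ∫ x in Ω, q x = 0 := hqle.antisymm (integral_nonneg hq0)
  have hae : q =ᵐ[volume.restrict Ω] 0 :=
    (integral_eq_zero_iff_of_nonneg hq0 (hint _ hqc)).1 hqint
  have hEq : EqOn q 0 Ω := Measure.eqOn_open_of_ae_eq hae hΩ
    (hqc.mono subset_closure) continuousOn_const
  intro x hx
  by_contra! hlt
  exact (sub_pos.2 (exp_sub_exp_mul_lt hlt)).ne' (hEq hx)

/-- In a bounded connected open `Ω ⊆ ℝⁿ` and for `λ > 0`, a stable solution
`u` of the Gelfand problem has the smallest `L^∞(Ω)` norm among all solutions `w`. -/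
theorem stable_solution_smallest_sup_norm
    (n : ℕ) (Ω : Set (EuclideanSpace ℝ (Fin n)))
    (hΩ_open : IsOpen Ω) (hΩ_bdd : Bornology.IsBounded Ω) (hΩ_conn : IsConnected Ω)
    (lam : ℝ) (hlam : 0 < lam)
    (u w : EuclideanSpace ℝ (Fin n) → ℝ)
    (hu : ContDiffOn ℝ 2 u (closure Ω))
    (hw : ContDiffOn ℝ 2 w (closure Ω))
    (hequ : ∀ x ∈ Ω, lap u x + lam * exp (u x) = 0)
    (heqw : ∀ x ∈ Ω, lap w x + lam * exp (w x) = 0)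
    (hbdryu : ∀ x ∈ frontier Ω, u x = 0)
    (hbdryw : ∀ x ∈ frontier Ω, w x = 0)
    (hstab : ∀ φ : EuclideanSpace ℝ (Fin n) → ℝ, ContDiff ℝ 1 φ → HasCompactSupport φ →
      tsupport φ ⊆ Ω →
      lam * ∫ x in Ω, exp (u x) * φ x ^ 2 ≤ ∫ x in Ω, ‖gradient φ x‖ ^ 2) :
    sSup ((fun x => |u x|) '' Ω) ≤ sSup ((fun x => |w x|) '' Ω) := by
  have hle := stable_le_of_solution hΩ_open hΩ_bdd hlam hu hw hequ heqw
    (fun x hx => (hbdryu x hx).trans (hbdryw x hx).symm) hstab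
  have hu0 := nonneg_of_lap_neg hΩ_open hΩ_bdd hu
    (fun x hx => by linarith [hequ x hx, mul_pos hlam (exp_pos (u x))]) hbdryu
  have hbdd : BddAbove ((fun x => |w x|) '' Ω) :=
    (hΩ_bdd.isCompact_closure.bddAbove_image hw.continuousOn.abs).mono
      (image_mono subset_closure)
  refine csSup_le (hΩ_conn.nonempty.image _) ?_
  rintro _ ⟨x, hx, rfl⟩
  refine le_trans ?_ (le_csSup hbdd (mem_image_of_mem _ hx))
  simpa only [abs_of_nonneg (hu0 x hx)] using (hle x hx).trans (le_abs_self _)
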